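/- Let G=(V,E) be a digraph with E nonempty, uniform positive capacities cap(e) = c for all e ∈ E and some rational c > 0, and α ∈ (0,1) rational. Then every feasible MMCFS solution A for (G,cap,α) (in particular the trivial solution A = E) satisfies |A| ≤ (1 + (1−α)/(2α)) · |O|, where O is any optimal feasible MMCFS solution. -/

import Mathlib

open Finset

variable {V : Type*}

/-- A flow for the commodity `(s,t)` of value `d`, supported on the edge set `E`. -/
def IsFlow [Fintype V] [DecidableEq V] (E : Finset (V × V)) (s t : V) (d : ℚ)
    (f : V × V → ℚ) : Prop :=
  (∀ e, 0 ≤ f e) ∧ (∀ e, e ∉ E → f e = 0) ∧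
    ∀ v : V,
      ((∑ e ∈ E.filter (fun e => e.2 = v), f e) -
          ∑ e ∈ E.filter (fun e => e.1 = v), f e) =
        (if v = t then d else 0) - (if v = s then d else 0)

/-- The traffic matrix `T` is routable in the edge set `A ⊆ E` via a multi-commodity flow. -/
def Routable [Fintype V] [DecidableEq V] (E : Finset (V × V)) (cap : V × V → ℚ)
    (T : V × V → ℚ) (A : Finset (V × V)) : Prop :=
  ∃ f : V × V → V × V → ℚ,
    (∀ p : V × V, IsFlow E p.1 p.2 (T p) (f p)) ∧
    (∀ e ∈ E, (∑ p : V × V, f p e) ≤ cap e) ∧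
    (∀ e ∈ E, e ∉ A → (∑ p : V × V, f p e) = 0)

/-- The traffic matrix `T_E` demanding `cap e` for each edge `e ∈ E` and `0` otherwise. -/
def trafficTE [Fintype V] [DecidableEq V] (E : Finset (V × V)) (cap : V × V → ℚ) :
    V × V → ℚ := fun p => if p ∈ E then cap p else 0

/-- A traffic matrix is a nonnegative function on pairs of vertices. -/
def IsTrafficMatrix (T : V × V → ℚ) : Prop := ∀ p, 0 ≤ T p

/-- `A ⊆ E` is a feasible MMCFS solution: every traffic matrix routable in `E`
remains routable in `A` after scaling by `α`. -/
def MMCFSFeasible [Fintype V] [DecidableEq V] (E : Finset (V × V)) (cap : V × V → ℚ)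
    (α : ℚ) (A : Finset (V × V)) : Prop :=
  A ⊆ E ∧ ∀ T : V × V → ℚ, IsTrafficMatrix T → Routable E cap T E →
    Routable E cap (fun p => α * T p) A

/-- Sending the capacity of each edge directly along that edge routes `trafficTE`. -/
theorem routable_trafficTE [Fintype V] [DecidableEq V] (E : Finset (V × V))
    (cap : V × V → ℚ) (hcap : ∀ e ∈ E, 0 ≤ cap e) :
    Routable E cap (trafficTE E cap) E := by
  refine ⟨fun p e => if p = e then trafficTE E cap p else 0, fun p => ⟨fun e => ?_, fun e he => ?_,
    fun v => ?_⟩, fun e he => ?_, fun e he he' => absurd he he'⟩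
  · simp only [trafficTE]
    split_ifs with _ hp
    exacts [hcap p hp, le_rfl, le_rfl]
  · dsimp only
    split_ifs with h
    · subst h
      simp [trafficTE, he]
    · rfl
  · rw [Finset.sum_ite_eq, Finset.sum_ite_eq]
    by_cases hp : p ∈ E <;> simp [trafficTE, hp, eq_comm]
  · simp [trafficTE, he]

namespace IsFlow

variable [Fintype V] [DecidableEq V] {E : Finset (V × V)} {s t : V} {d : ℚ} {f : V × V → ℚ}

theorem le_sum_out (h : IsFlow E s t d f) (hst : s ≠ t) :
    d ≤ ∑ e ∈ E with e.1 = s, f e := by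
  have h₁ := h.2.2 s
  have h₂ : 0 ≤ ∑ e ∈ E with e.2 = s, f e := Finset.sum_nonneg fun e _ => h.1 e
  simp only [if_neg hst, if_true] at h₁
  linarith

theorem le_sum_in (h : IsFlow E s t d f) (hst : s ≠ t) :
    d ≤ ∑ e ∈ E with e.2 = t, f e := by
  have h₁ := h.2.2 t
  have h₂ : 0 ≤ ∑ e ∈ E with e.1 = t, f e := Finset.sum_nonneg fun e _ => h.1 e
  simp only [if_neg hst.symm, if_true] at h₁
  linarith

theorem le_sum (h : IsFlow E s t d f) (hst : s ≠ t) : d ≤ ∑ e ∈ E, f e :=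
  (h.le_sum_out hst).trans <|
    Finset.sum_le_sum_of_subset_of_nonneg (Finset.filter_subset _ _) fun e _ _ => h.1 e

/-- A flow avoiding the edge `(s, t)` uses twice its value in total edge capacity. -/
theorem two_mul_le_sum (h : IsFlow E s t d f) (hst : s ≠ t) (h₀ : f (s, t) = 0) :
    2 * d ≤ ∑ e ∈ E, f e := by
  have key : (∑ e ∈ E with e.1 = s, f e) + ∑ e ∈ E with e.2 = t, f e ≤ ∑ e ∈ E, f e := by
    rw [Finset.sum_filter, Finset.sum_filter, ← Finset.sum_add_distrib]
    refine Finset.sum_le_sum fun e _ => ?_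
    have he := h.1 e
    obtain ⟨a, b⟩ := e
    by_cases ha : a = s <;> by_cases hb : b = t
    · subst ha hb
      simp [h₀]
    all_goals simp [ha, hb, he]
  linarith [h.le_sum_out hst, h.le_sum_in hst]

end IsFlow

theorem stmt5 [Fintype V] [DecidableEq V] (E : Finset (V × V)) (hne : E.Nonempty)
    (hE : ∀ e ∈ E, e.1 ≠ e.2) (cap : V × V → ℚ) (c : ℚ) (hc : 0 < c)
    (hcap : ∀ e ∈ E, cap e = c)
    (α : ℚ) (h0 : 0 < α) (h1 : α < 1) (O A : Finset (V × V))
    (hOfeas : MMCFSFeasible E cap α O)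
    (hOopt : ∀ B : Finset (V × V), MMCFSFeasible E cap α B → O.card ≤ B.card)
    (hAfeas : MMCFSFeasible E cap α A) :
    (A.card : ℚ) ≤ (1 + (1 - α) / (2 * α)) * O.card := by
  obtain ⟨hOE, hO⟩ := hOfeas
  obtain ⟨f, hflow, hle, hzero⟩ := hO (trafficTE E cap)
    (fun p => by
      simp only [trafficTE]
      split_ifs with hp
      exacts [hcap p hp ▸ hc.le, le_rfl])
    (routable_trafficTE E cap fun e he => hcap e he ▸ hc.le)
  have hval : ∀ p ∈ E, α * trafficTE E cap p = α * c := fun p hp => by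
    simp [trafficTE, hp, hcap p hp]
  have hin : (O.card : ℚ) * (α * c) ≤ ∑ p ∈ O, ∑ e ∈ E, f p e := by
    rw [← nsmul_eq_mul]
    refine Finset.card_nsmul_le_sum _ _ _ fun p hp => ?_
    rw [← hval p (hOE hp)]
    exact (hflow p).le_sum (hE p (hOE hp))
  have hout : ((E \ O).card : ℚ) * (2 * (α * c)) ≤ ∑ p ∈ E \ O, ∑ e ∈ E, f p e := by
    rw [← nsmul_eq_mul]
    refine Finset.card_nsmul_le_sum _ _ _ fun p hp => ?_
    obtain ⟨hpE, hpO⟩ := Finset.mem_sdiff.1 hp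
    rw [← hval p hpE]
    exact (hflow p).two_mul_le_sum (hE p hpE) <|
      (Finset.sum_eq_zero_iff_of_nonneg fun q _ => (hflow q).1 p).1 (hzero p hpE hpO) p
        (Finset.mem_univ p)
  have htotal : ∑ p ∈ E, ∑ e ∈ E, f p e ≤ (O.card : ℚ) * c := by
    calc ∑ p ∈ E, ∑ e ∈ E, f p e ≤ ∑ p, ∑ e ∈ E, f p e :=
          Finset.sum_le_sum_of_subset_of_nonneg (Finset.subset_univ _)
            fun p _ _ => Finset.sum_nonneg fun e _ => (hflow p).1 e
      _ = ∑ e ∈ E, ∑ p, f p e := Finset.sum_comm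
      _ = ∑ e ∈ O, ∑ p, f p e :=
          (Finset.sum_subset hOE fun e he heO => hzero e he heO).symm
      _ ≤ O.card • c := Finset.sum_le_card_nsmul _ _ _ fun e he =>
          hcap e (hOE he) ▸ hle e (hOE he)
      _ = (O.card : ℚ) * c := nsmul_eq_mul _ _
  have hsplit := Finset.sum_sdiff (f := fun p => ∑ e ∈ E, f p e) hOE
  have hcard : ((E \ O).card : ℚ) + O.card = E.card := by
    exact_mod_cast Finset.card_sdiff_add_card_eq_card hOE
  have hAE : (A.card : ℚ) ≤ E.card := by exact_mod_cast Finset.card_le_card hAfeas.1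
  have hbound : 2 * α * E.card ≤ (1 + α) * O.card := by
    refine le_of_mul_le_mul_right ?_ hc
    rw [← hcard]
    linarith
  refine hAE.trans ?_
  rw [show (1 + (1 - α) / (2 * α)) * (O.card : ℚ) = (1 + α) * O.card / (2 * α) by
    field_simp; ring, le_div_iff₀ (by positivity)]
  linarith
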